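/- arXiv:2302.05404 — 11 statements merged into one kernel-verified Lean document; each statement's English description precedes it below -/
import Mathlib

section
/- Assume the source condition r0 ∈ range(T ∘ T*). Then for every g ∈ G: T(T* g) = r0 if and only if T* g = h0. -/
open scoped RealInnerProductSpace

/-- Under the source condition `r0 ∈ range (T ∘ T*)`, for every `g`,
`T (T* g) = r0` iff `T* g = h0`, where `h0` is the least-norm solution. -/
theorem source_condition_adjoint_char
    {H G : Type*} [NormedAddCommGroup H] [InnerProductSpace ℝ H] [CompleteSpace H]
    [NormedAddCommGroup G] [InnerProductSpace ℝ G] [CompleteSpace G]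
    (T : H →L[ℝ] G) (r0 : G) (hr0 : r0 ∈ Set.range T)
    (h0 : H) (hh0 : T h0 = r0) (hmin : ∀ h : H, T h = r0 → ‖h0‖ ≤ ‖h‖)
    (hsrc : ∃ g : G, T (ContinuousLinearMap.adjoint T g) = r0) :
    ∀ g : G, T (ContinuousLinearMap.adjoint T g) = r0 ↔ ContinuousLinearMap.adjoint T g = h0 := by
  intro g
  constructor
  · intro hg
    have hle := hmin _ hg
    have horth : inner ℝ (ContinuousLinearMap.adjoint T g)
        (h0 - ContinuousLinearMap.adjoint T g) = 0 := by
      rw [ContinuousLinearMap.adjoint_inner_left, map_sub, hg, hh0, sub_self, inner_zero_right]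
    have hpy := norm_add_sq_real (ContinuousLinearMap.adjoint T g)
      (h0 - ContinuousLinearMap.adjoint T g)
    rw [horth, add_sub_cancel] at hpy
    have hz : ‖h0 - ContinuousLinearMap.adjoint T g‖ = 0 := by
      have h1 := norm_nonneg h0
      have h2 : ‖h0‖ ^ 2 ≤ ‖ContinuousLinearMap.adjoint T g‖ ^ 2 :=
        pow_le_pow_left₀ h1 hle 2
      have h3 : ‖h0 - ContinuousLinearMap.adjoint T g‖ ^ 2 = 0 :=
        le_antisymm (by linarith) (sq_nonneg _)
      exact pow_eq_zero_iff (two_ne_zero) |>.mp h3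
    exact (sub_eq_zero.mp (norm_eq_zero.mp hz)).symm
  · intro hg
    rw [hg, hh0]
end

section
/- Assume the source condition r0 ∈ range(T ∘ T*). Then a pair (h', g') ∈ H × G is a saddle point of L over H × G if and only if h' = h0 and T* g' = h0. -/
open scoped RealInnerProductSpace

/-- Under the source condition, `(h', g')` is a saddle point of the Lagrangian
`L(h,g) = (1/2)⟨h,h⟩ + ⟨r0 - T h, g⟩` over `H × G` iff `h' = h0` and `T* g' = h0`. -/
theorem saddle_points_characterization
    {H G : Type*} [NormedAddCommGroup H] [InnerProductSpace ℝ H] [CompleteSpace H]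
    [NormedAddCommGroup G] [InnerProductSpace ℝ G] [CompleteSpace G]
    (T : H →L[ℝ] G) (r0 : G) (hr0 : r0 ∈ Set.range T)
    (h0 : H) (hh0 : T h0 = r0) (hmin : ∀ h : H, T h = r0 → ‖h0‖ ≤ ‖h‖)
    (hsrc : ∃ g : G, T (ContinuousLinearMap.adjoint T g) = r0)
    (L : H → G → ℝ)
    (hL : ∀ (h : H) (g : G), L h g = (1/2) * ⟪h, h⟫ + ⟪r0 - T h, g⟫)
    (h' : H) (g' : G) :
    ((∀ h : H, L h g' ≥ L h' g') ∧ (∀ g : G, L h' g' ≥ L h' g)) ↔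
      (h' = h0 ∧ ContinuousLinearMap.adjoint T g' = h0) := by
  have key : ∀ (h : H) (g : G), L h g =
      (1/2) * ‖h - ContinuousLinearMap.adjoint T g‖ ^ 2
        - (1/2) * ‖ContinuousLinearMap.adjoint T g‖ ^ 2 + ⟪r0, g⟫ := by
    intro h g
    rw [hL, norm_sub_sq_real, inner_sub_left, ContinuousLinearMap.adjoint_inner_right,
      real_inner_self_eq_norm_sq]
    ring
  constructor
  · rintro ⟨h1, h2⟩
    have e1 : h' = ContinuousLinearMap.adjoint T g' := by
      have := h1 (ContinuousLinearMap.adjoint T g')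
      rw [key, key, sub_self, norm_zero] at this
      have h3 : ‖h' - ContinuousLinearMap.adjoint T g'‖ = 0 := by
        nlinarith [norm_nonneg (h' - ContinuousLinearMap.adjoint T g')]
      exact sub_eq_zero.mp (norm_eq_zero.mp h3)
    have e2 : r0 = T h' := by
      have := h2 (g' + (r0 - T h'))
      rw [hL, hL, inner_add_right, real_inner_self_eq_norm_sq (r0 - T h')] at this
      have h3 : ‖r0 - T h'‖ = 0 := by
        nlinarith [norm_nonneg (r0 - T h')]
      exact sub_eq_zero.mp (norm_eq_zero.mp h3)
    have e3 : ⟪h0 - h', h'⟫ = 0 := by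
      nth_rewrite 2 [e1]
      rw [ContinuousLinearMap.adjoint_inner_right, map_sub, hh0, ← e2, sub_self,
        inner_zero_left]
    have e4 : ‖h0‖ ^ 2 = ‖h0 - h'‖ ^ 2 + ‖h'‖ ^ 2 := by
      have := norm_add_sq_real (h0 - h') h'
      rw [sub_add_cancel, e3] at this
      linarith
    have e5 := hmin h' e2.symm
    have e6 : ‖h0 - h'‖ = 0 := by
      nlinarith [norm_nonneg (h0 - h'), norm_nonneg h0, norm_nonneg h']
    have e7 : h0 = h' := sub_eq_zero.mp (norm_eq_zero.mp e6)
    exact ⟨e7.symm, by rw [e7, ← e1]⟩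
  · rintro ⟨rfl, h2⟩
    refine ⟨fun h => ?_, fun g => ?_⟩
    · rw [key, key, h2, sub_self, norm_zero]
      nlinarith [sq_nonneg ‖h - h'‖]
    · rw [hL, hL, hh0]
      simp
end

section
/- (i) For every g ∈ G, L(h0, g) = (1/2)‖h0‖². (ii) For every h ∈ H with h ≠ h0, there exists g ∈ G such that L(h, g) > (1/2)‖h0‖². (Hence h0 is the unique minimizer over H of the worst-case objective h ↦ sup_{g ∈ G} L(h,g), and this holds without any source condition.) -/
open scoped RealInnerProductSpace

/-- (i) `L(h0, g) = (1/2)‖h0‖²` for every `g`; (ii) for every `h ≠ h0` there is a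
`g` with `L(h, g) > (1/2)‖h0‖²`.  Hence `h0` is the unique minimizer of the
worst-case objective, without any source condition. -/
theorem h0_unique_minimizer_worst_case
    {H G : Type*} [NormedAddCommGroup H] [InnerProductSpace ℝ H] [CompleteSpace H]
    [NormedAddCommGroup G] [InnerProductSpace ℝ G] [CompleteSpace G]
    (T : H →L[ℝ] G) (r0 : G) (hr0 : r0 ∈ Set.range T)
    (h0 : H) (hh0 : T h0 = r0) (hmin : ∀ h : H, T h = r0 → ‖h0‖ ≤ ‖h‖)
    (L : H → G → ℝ)
    (hL : ∀ (h : H) (g : G), L h g = (1/2) * ⟪h, h⟫ + ⟪r0 - T h, g⟫) :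
    (∀ g : G, L h0 g = (1/2) * ‖h0‖ ^ 2) ∧
      (∀ h : H, h ≠ h0 → ∃ g : G, L h g > (1/2) * ‖h0‖ ^ 2) := by
  refine ⟨fun g => ?_, fun h hne => ?_⟩
  · rw [hL, hh0, sub_self, inner_zero_left, real_inner_self_eq_norm_sq, add_zero]
  · by_cases hT : T h = r0
    · refine ⟨0, ?_⟩
      rw [hL, inner_zero_right, real_inner_self_eq_norm_sq, add_zero]
      have hm := hmin ((1/2 : ℝ) • (h + h0)) (by
        rw [map_smul, map_add, hT, hh0, ← two_smul ℝ r0, smul_smul]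
        norm_num)
      rw [norm_smul, Real.norm_of_nonneg (by norm_num)] at hm
      have hp := parallelogram_law_with_norm ℝ h h0
      have hd : 0 < ‖h - h0‖ := norm_pos_iff.mpr (sub_ne_zero.mpr hne)
      have h1 := norm_nonneg h0
      have h2 : (2 * ‖h0‖) * (2 * ‖h0‖) ≤ ‖h + h0‖ * ‖h + h0‖ :=
        mul_self_le_mul_self (by positivity) (by linarith)
      have h3 := mul_pos hd hd
      nlinarith
    · have hd : 0 < ‖r0 - T h‖ := norm_pos_iff.mpr (sub_ne_zero.mpr (Ne.symm hT))
      refine ⟨((‖h0‖ ^ 2 + 1) / ‖r0 - T h‖ ^ 2) • (r0 - T h), ?_⟩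
      rw [hL, inner_smul_right, real_inner_self_eq_norm_sq, real_inner_self_eq_norm_sq,
        div_mul_cancel₀ _ (by positivity)]
      nlinarith [sq_nonneg ‖h‖, sq_nonneg ‖h0‖]
end

section
/- Assume the source condition r0 ∈ range(T ∘ T*). Then for g' ∈ G the following are equivalent: (a) L(T* g, g) ≤ L(T* g', g') for all g ∈ G (i.e., g' maximizes over G the inner-infimum objective g ↦ min_{h ∈ H} L(h,g) = L(T* g, g)); (b) T* g' = h0. -/
open scoped RealInnerProductSpace

/-- Under the source condition, `g'` maximizes the inner-infimum objective
`g ↦ L(T* g, g)` over `G` iff `T* g' = h0`. -/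
theorem inner_inf_maximizers_characterization
    {H G : Type*} [NormedAddCommGroup H] [InnerProductSpace ℝ H] [CompleteSpace H]
    [NormedAddCommGroup G] [InnerProductSpace ℝ G] [CompleteSpace G]
    (T : H →L[ℝ] G) (r0 : G) (hr0 : r0 ∈ Set.range T)
    (h0 : H) (hh0 : T h0 = r0) (hmin : ∀ h : H, T h = r0 → ‖h0‖ ≤ ‖h‖)
    (hsrc : ∃ g : G, T (ContinuousLinearMap.adjoint T g) = r0)
    (L : H → G → ℝ)
    (hL : ∀ (h : H) (g : G), L h g = (1/2) * ⟪h, h⟫ + ⟪r0 - T h, g⟫)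
    (g' : G) :
    (∀ g : G, L (ContinuousLinearMap.adjoint T g) g ≤
        L (ContinuousLinearMap.adjoint T g') g') ↔
      ContinuousLinearMap.adjoint T g' = h0 := by
  have key : ∀ g : G, L (ContinuousLinearMap.adjoint T g) g =
      (1/2) * ‖h0‖ ^ 2 - (1/2) * ‖ContinuousLinearMap.adjoint T g - h0‖ ^ 2 := by
    intro g
    have e1 : ⟪r0, g⟫ = ⟪ContinuousLinearMap.adjoint T g, h0⟫ := by
      rw [ContinuousLinearMap.adjoint_inner_left, hh0, real_inner_comm]
    have e2 : ⟪T (ContinuousLinearMap.adjoint T g), g⟫ =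
        ‖ContinuousLinearMap.adjoint T g‖ ^ 2 := by
      rw [← ContinuousLinearMap.adjoint_inner_right, real_inner_self_eq_norm_sq]
    rw [hL, inner_sub_left, e1, e2, real_inner_self_eq_norm_sq, norm_sub_sq_real]
    ring
  obtain ⟨gs, hgs⟩ := hsrc
  have hs : ContinuousLinearMap.adjoint T gs = h0 := by
    have h1 := hmin _ hgs
    have e1 : ⟪ContinuousLinearMap.adjoint T gs, h0⟫ =
        ‖ContinuousLinearMap.adjoint T gs‖ ^ 2 := by
      rw [ContinuousLinearMap.adjoint_inner_left, hh0, ← hgs,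
        ← ContinuousLinearMap.adjoint_inner_left, real_inner_self_eq_norm_sq]
    have e2 := norm_sub_sq_real (ContinuousLinearMap.adjoint T gs) h0
    rw [e1] at e2
    have h2 := pow_le_pow_left₀ (norm_nonneg h0) h1 2
    have h3 : ‖ContinuousLinearMap.adjoint T gs - h0‖ ^ 2 = 0 :=
      le_antisymm (by linarith) (sq_nonneg _)
    exact sub_eq_zero.mp (norm_eq_zero.mp (pow_eq_zero_iff two_ne_zero |>.mp h3))
  constructor
  · intro h
    have h1 := h gs
    rw [key, key, hs, sub_self, norm_zero] at h1
    have h3 : ‖ContinuousLinearMap.adjoint T g' - h0‖ ^ 2 = 0 :=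
      le_antisymm (by linarith) (sq_nonneg _)
    exact sub_eq_zero.mp (norm_eq_zero.mp (pow_eq_zero_iff two_ne_zero |>.mp h3))
  · intro h g
    rw [key, key, h, sub_self, norm_zero]
    have := sq_nonneg ‖ContinuousLinearMap.adjoint T g - h0‖
    linarith
end

section
/- There exists a saddle point of L over H × G (i.e., a pair (h',g') ∈ H × G with L(h,g') ≥ L(h',g') ≥ L(h',g) for all h ∈ H and g ∈ G) if and only if the source condition holds, i.e., r0 ∈ range(T ∘ T*). -/
open scoped RealInnerProductSpace

/-- A saddle point of the Lagrangian `L` over `H × G` exists iff the source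
condition `r0 ∈ range (T ∘ T*)` holds. -/
theorem saddle_point_exists_iff_source_condition
    {H G : Type*} [NormedAddCommGroup H] [InnerProductSpace ℝ H] [CompleteSpace H]
    [NormedAddCommGroup G] [InnerProductSpace ℝ G] [CompleteSpace G]
    (T : H →L[ℝ] G) (r0 : G) (hr0 : r0 ∈ Set.range T)
    (L : H → G → ℝ)
    (hL : ∀ (h : H) (g : G), L h g = (1/2) * ⟪h, h⟫ + ⟪r0 - T h, g⟫) :
    (∃ (h' : H) (g' : G), (∀ h : H, L h g' ≥ L h' g') ∧ (∀ g : G, L h' g' ≥ L h' g)) ↔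
      (∃ g : G, T (ContinuousLinearMap.adjoint T g) = r0) := by
  have key : ∀ (h : H) (g : G),
      L h g = (1/2) * ⟪h, h⟫ + ⟪r0, g⟫ - ⟪h, ContinuousLinearMap.adjoint T g⟫ := by
    intro h g
    rw [hL, inner_sub_left, ContinuousLinearMap.adjoint_inner_right]
    ring
  constructor
  · rintro ⟨h', g', h1, h2⟩
    have e1 : r0 - T h' = 0 := by
      have h3 := h2 (g' + (r0 - T h'))
      rw [hL, hL, inner_add_right] at h3
      have h4 : ⟪r0 - T h', r0 - T h'⟫ ≤ 0 := by linarith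
      exact inner_self_eq_zero.mp (le_antisymm h4 real_inner_self_nonneg)
    have e2 : h' - ContinuousLinearMap.adjoint T g' = 0 := by
      have h3 := h1 (ContinuousLinearMap.adjoint T g')
      rw [key, key] at h3
      have h4 := real_inner_sub_sub_self h' (ContinuousLinearMap.adjoint T g')
      have h5 : ⟪h' - ContinuousLinearMap.adjoint T g',
          h' - ContinuousLinearMap.adjoint T g'⟫ ≤ 0 := by linarith
      exact inner_self_eq_zero.mp (le_antisymm h5 real_inner_self_nonneg)
    exact ⟨g', by rw [← sub_eq_zero.mp e2]; exact (sub_eq_zero.mp e1).symm⟩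
  · rintro ⟨g, hg⟩
    refine ⟨ContinuousLinearMap.adjoint T g, g, fun h => ?_, fun k => ?_⟩
    · rw [key, key]
      have h4 := real_inner_sub_sub_self h (ContinuousLinearMap.adjoint T g)
      have h5 : 0 ≤ ⟪h - ContinuousLinearMap.adjoint T g,
          h - ContinuousLinearMap.adjoint T g⟫ := real_inner_self_nonneg
      linarith
    · rw [hL, hL, hg]
      simp
end

section
/- Let 𝓗 ⊆ H and 𝓖 ⊆ G be subsets such that h0 ∈ 𝓗 and there exists ḡ0 ∈ 𝓖 with T* ḡ0 = h0. Assume that for each h ∈ 𝓗 the set {L(h,g) : g ∈ 𝓖} is bounded above. If ĥ ∈ 𝓗 satisfies sup{L(ĥ,g) : g ∈ 𝓖} ≤ sup{L(h,g) : g ∈ 𝓖} for every h ∈ 𝓗, then ĥ = h0. That is, h0 is the unique minimizer over 𝓗 of the restricted worst-case objective h ↦ sup_{g ∈ 𝓖} L(h,g). -/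
open scoped RealInnerProductSpace

/-- Identification over restricted classes: if `h0 ∈ 𝓗` and some `ḡ0 ∈ 𝓖`
satisfies `T* ḡ0 = h0`, then `h0` is the unique minimizer over `𝓗` of the
restricted worst-case objective `h ↦ sup_{g ∈ 𝓖} L(h,g)`. -/
theorem identification_restricted_classes
    {H G : Type*} [NormedAddCommGroup H] [InnerProductSpace ℝ H] [CompleteSpace H]
    [NormedAddCommGroup G] [InnerProductSpace ℝ G] [CompleteSpace G]
    (T : H →L[ℝ] G) (r0 : G) (hr0 : r0 ∈ Set.range T)
    (h0 : H) (hh0 : T h0 = r0) (hmin : ∀ h : H, T h = r0 → ‖h0‖ ≤ ‖h‖)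
    (L : H → G → ℝ)
    (hL : ∀ (h : H) (g : G), L h g = (1/2) * ⟪h, h⟫ + ⟪r0 - T h, g⟫)
    (𝓗 : Set H) (𝓖 : Set G)
    (hH : h0 ∈ 𝓗) (hG : ∃ g0 ∈ 𝓖, ContinuousLinearMap.adjoint T g0 = h0)
    (hbdd : ∀ h ∈ 𝓗, BddAbove ((fun g => L h g) '' 𝓖))
    (hHat : H) (hmem : hHat ∈ 𝓗)
    (hargmin : ∀ h ∈ 𝓗, sSup ((fun g => L hHat g) '' 𝓖) ≤ sSup ((fun g => L h g) '' 𝓖)) :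
    hHat = h0 := by
  obtain ⟨g0, hg0, hadj⟩ := hG
  have h1 : L hHat g0 ≤ sSup ((fun g => L hHat g) '' 𝓖) :=
    le_csSup (hbdd hHat hmem) ⟨g0, hg0, rfl⟩
  have h2 : sSup ((fun g => L h0 g) '' 𝓖) ≤ (1/2) * ⟪h0, h0⟫ := by
    refine csSup_le (Set.Nonempty.image _ ⟨g0, hg0⟩) ?_
    rintro _ ⟨g, _, rfl⟩
    simp [hL, hh0]
  have h3 := (h1.trans (hargmin h0 hH)).trans h2
  have h4 : ⟪r0 - T hHat, g0⟫ = ⟪h0 - hHat, h0⟫ := by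
    rw [← hh0, ← map_sub, ← ContinuousLinearMap.adjoint_inner_right, hadj]
  rw [hL, h4, inner_sub_left] at h3
  have h5 : ⟪hHat - h0, hHat - h0⟫ ≤ 0 := by
    rw [real_inner_sub_sub_self]
    linarith
  exact sub_eq_zero.mp (inner_self_eq_zero.mp (le_antisymm h5 real_inner_self_nonneg))
end

section
/- Let 𝓗 ⊆ H and 𝓖 ⊆ G be subsets such that h0 ∈ 𝓗 and there exists ḡ0 ∈ 𝓖 with T* ḡ0 = h0. Let M ≥ 0 and let L_n : H × G → ℝ be any function satisfying |L_n(h,g) − L(h,g)| ≤ M for all h ∈ 𝓗 and g ∈ 𝓖. Assume that for each h ∈ 𝓗 the set {L_n(h,g) : g ∈ 𝓖} is bounded above. If ĥ ∈ 𝓗 satisfies sup{L_n(ĥ,g) : g ∈ 𝓖} ≤ sup{L_n(h,g) : g ∈ 𝓖} for every h ∈ 𝓗, then ‖ĥ − h0‖ ≤ 2√M. -/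
open scoped RealInnerProductSpace

/-- Finite-sample guarantee: if `L_n` approximates `L` uniformly to accuracy `M`
over `𝓗 × 𝓖` and `hHat` minimizes the empirical worst-case objective over `𝓗`,
then `‖hHat - h0‖ ≤ 2√M`. -/
theorem finite_sample_L2_rate
    {H G : Type*} [NormedAddCommGroup H] [InnerProductSpace ℝ H] [CompleteSpace H]
    [NormedAddCommGroup G] [InnerProductSpace ℝ G] [CompleteSpace G]
    (T : H →L[ℝ] G) (r0 : G) (hr0 : r0 ∈ Set.range T)
    (h0 : H) (hh0 : T h0 = r0) (hmin : ∀ h : H, T h = r0 → ‖h0‖ ≤ ‖h‖)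
    (L : H → G → ℝ)
    (hL : ∀ (h : H) (g : G), L h g = (1/2) * ⟪h, h⟫ + ⟪r0 - T h, g⟫)
    (𝓗 : Set H) (𝓖 : Set G)
    (hH : h0 ∈ 𝓗) (hG : ∃ g0 ∈ 𝓖, ContinuousLinearMap.adjoint T g0 = h0)
    (M : ℝ) (hM : 0 ≤ M)
    (Ln : H → G → ℝ)
    (hLn : ∀ h ∈ 𝓗, ∀ g ∈ 𝓖, |Ln h g - L h g| ≤ M)
    (hbdd : ∀ h ∈ 𝓗, BddAbove ((fun g => Ln h g) '' 𝓖))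
    (hHat : H) (hmem : hHat ∈ 𝓗)
    (hargmin : ∀ h ∈ 𝓗, sSup ((fun g => Ln hHat g) '' 𝓖) ≤ sSup ((fun g => Ln h g) '' 𝓖)) :
    ‖hHat - h0‖ ≤ 2 * Real.sqrt M := by
  obtain ⟨g0, hg0, hTg⟩ := hG
  have h1 : Ln hHat g0 ≤ sSup ((fun g => Ln hHat g) '' 𝓖) :=
    le_csSup (hbdd hHat hmem) ⟨g0, hg0, rfl⟩
  have h2 : sSup ((fun g => Ln h0 g) '' 𝓖) ≤ (1/2) * ⟪h0, h0⟫ + M := by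
    refine csSup_le ⟨_, g0, hg0, rfl⟩ ?_
    rintro _ ⟨g, hg, rfl⟩
    have h := (abs_le.mp (hLn h0 hH g hg)).2
    rw [hL, hh0, sub_self, inner_zero_left] at h
    show Ln h0 g ≤ _
    linarith
  have h3 := (abs_le.mp (hLn hHat hmem g0 hg0)).1
  have h4 := hargmin h0 hH
  have h5 : L hHat g0 = (1/2) * ⟪hHat, hHat⟫ + (⟪h0, h0⟫ - ⟪hHat, h0⟫) := by
    rw [hL, ← hh0, ← map_sub, ← ContinuousLinearMap.adjoint_inner_right, hTg, inner_sub_left]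
  have h6 : ‖hHat - h0‖ ^ 2 = ⟪hHat, hHat⟫ - 2 * ⟪hHat, h0⟫ + ⟪h0, h0⟫ := by
    rw [norm_sub_sq_real, real_inner_self_eq_norm_sq, real_inner_self_eq_norm_sq]
  refine (sq_le_sq₀ (norm_nonneg _) (by positivity)).mp ?_
  rw [mul_pow, Real.sq_sqrt hM]
  linarith
end

section
/- Let 𝓗 ⊆ H and 𝓖 ⊆ G be subsets, and let C_H, C_G, ε_h, ε_g, M ≥ 0. Assume: the operator norm of T is at most 1; ‖h‖ ≤ C_H for all h ∈ 𝓗 and ‖h0‖ ≤ C_H; ‖g‖ ≤ C_G for all g ∈ 𝓖; there exists h† ∈ 𝓗 with ‖h† − h0‖ ≤ ε_h; there exists ḡ0 ∈ G with T* ḡ0 = h0 and g† ∈ 𝓖 with ‖g† − ḡ0‖ ≤ ε_g. Let L_n : H × G → ℝ satisfy |L_n(h,g) − L(h,g)| ≤ M for all h ∈ 𝓗, g ∈ 𝓖, assume for each h ∈ 𝓗 the set {L_n(h,g) : g ∈ 𝓖} is bounded above, and suppose ĥ ∈ 𝓗 satisfies sup{L_n(ĥ,g) : g ∈ 𝓖}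 ≤ sup{L_n(h,g) : g ∈ 𝓖} for every h ∈ 𝓗. Then (1/2)‖ĥ − h0‖² ≤ (2·C_H + C_G)·ε_h + 2·C_H·ε_g + 2·M. -/
open scoped RealInnerProductSpace

/-- Finite-sample guarantee under misspecification: with bounded classes,
approximate realizability (`ε_h`, `ε_g`) and a uniform empirical approximation
error `M`, any empirical worst-case minimizer `hHat` satisfies
`(1/2)‖hHat - h0‖² ≤ (2 C_H + C_G) ε_h + 2 C_H ε_g + 2 M`. -/
theorem finite_sample_misspecification
    {H G : Type*} [NormedAddCommGroup H] [InnerProductSpace ℝ H] [CompleteSpace H]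
    [NormedAddCommGroup G] [InnerProductSpace ℝ G] [CompleteSpace G]
    (T : H →L[ℝ] G) (r0 : G) (hr0 : r0 ∈ Set.range T)
    (h0 : H) (hh0 : T h0 = r0) (hmin : ∀ h : H, T h = r0 → ‖h0‖ ≤ ‖h‖)
    (L : H → G → ℝ)
    (hL : ∀ (h : H) (g : G), L h g = (1/2) * ⟪h, h⟫ + ⟪r0 - T h, g⟫)
    (𝓗 : Set H) (𝓖 : Set G)
    (CH CG εh εg M : ℝ)
    (hCH : 0 ≤ CH) (hCG : 0 ≤ CG) (hεh : 0 ≤ εh) (hεg : 0 ≤ εg) (hM : 0 ≤ M)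
    (hTnorm : ‖T‖ ≤ 1)
    (hHbound : ∀ h ∈ 𝓗, ‖h‖ ≤ CH) (hh0bound : ‖h0‖ ≤ CH)
    (hGbound : ∀ g ∈ 𝓖, ‖g‖ ≤ CG)
    (hdag : ∃ hd ∈ 𝓗, ‖hd - h0‖ ≤ εh)
    (hgdag : ∃ g0 : G, ContinuousLinearMap.adjoint T g0 = h0 ∧
      ∃ gd ∈ 𝓖, ‖gd - g0‖ ≤ εg)
    (Ln : H → G → ℝ)
    (hLn : ∀ h ∈ 𝓗, ∀ g ∈ 𝓖, |Ln h g - L h g| ≤ M)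
    (hbdd : ∀ h ∈ 𝓗, BddAbove ((fun g => Ln h g) '' 𝓖))
    (hHat : H) (hmem : hHat ∈ 𝓗)
    (hargmin : ∀ h ∈ 𝓗, sSup ((fun g => Ln hHat g) '' 𝓖) ≤ sSup ((fun g => Ln h g) '' 𝓖)) :
    (1/2) * ‖hHat - h0‖ ^ 2 ≤ (2 * CH + CG) * εh + 2 * CH * εg + 2 * M := by
  obtain ⟨hd, hdm, hde⟩ := hdag
  obtain ⟨g0, hg0, gd, gdm, gde⟩ := hgdag
  have hT : ∀ x : H, ‖T x‖ ≤ ‖x‖ := fun x => by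
    have h1 := T.le_opNorm x
    have h2 := mul_le_mul_of_nonneg_right hTnorm (norm_nonneg x)
    linarith
  have hlow : L hHat gd - M ≤ sSup ((fun g => Ln hHat g) '' 𝓖) := by
    have h1 := le_csSup (hbdd hHat hmem) (Set.mem_image_of_mem (fun g => Ln hHat g) gdm)
    have h2 := (abs_le.mp (hLn hHat hmem gd gdm)).1
    linarith
  have hup : sSup ((fun g => Ln hd g) '' 𝓖) ≤ (1/2) * ‖hd‖ ^ 2 + εh * CG + M := by
    apply csSup_le ⟨_, Set.mem_image_of_mem _ gdm⟩
    rintro _ ⟨g, hg, rfl⟩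
    have h2 := (abs_le.mp (hLn hd hdm g hg)).2
    have h3 : ⟪r0 - T hd, g⟫ ≤ εh * CG := by
      refine (real_inner_le_norm _ _).trans ?_
      refine mul_le_mul ?_ (hGbound g hg) (norm_nonneg _) hεh
      rw [← hh0, ← map_sub]
      refine (hT _).trans ?_
      rwa [norm_sub_rev]
    rw [hL, real_inner_self_eq_norm_sq] at h2
    simp only
    linarith
  have hch := hargmin hd hdm
  have hLe : L hHat gd = (1/2) * ‖hHat‖ ^ 2 + ⟪h0 - hHat, h0⟫ + ⟪T (h0 - hHat), gd - g0⟫ := by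
    have h1 : ⟪h0 - hHat, h0⟫ = ⟪T (h0 - hHat), g0⟫ := by
      conv_lhs => rw [← hg0]
      rw [ContinuousLinearMap.adjoint_inner_right, hg0]
    rw [hL, real_inner_self_eq_norm_sq, h1, ← hh0, ← map_sub, inner_sub_right]
    ring
  have hcs : -(2 * CH * εg) ≤ ⟪T (h0 - hHat), gd - g0⟫ := by
    have h1 := (abs_le.mp (abs_real_inner_le_norm (T (h0 - hHat)) (gd - g0))).1
    have h2 : ‖T (h0 - hHat)‖ * ‖gd - g0‖ ≤ 2 * CH * εg := by
      refine mul_le_mul ?_ gde (norm_nonneg _) (by positivity)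
      refine (hT _).trans ((norm_sub_le _ _).trans ?_)
      linarith [hHbound hHat hmem]
    linarith
  have hexp := norm_sub_sq_real hHat h0
  have hin : ⟪h0 - hHat, h0⟫ = ‖h0‖ ^ 2 - ⟪hHat, h0⟫ := by
    rw [inner_sub_left, real_inner_self_eq_norm_sq]
  have hsq : ‖hd‖ ^ 2 - ‖h0‖ ^ 2 ≤ 2 * CH * εh := by
    have h1 : ‖hd‖ - ‖h0‖ ≤ εh := (norm_sub_norm_le _ _).trans hde
    have h2 : ‖hd‖ + ‖h0‖ ≤ 2 * CH := by linarith [hHbound hd hdm]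
    have h3 : 0 ≤ ‖hd‖ + ‖h0‖ := by positivity
    nlinarith [mul_le_mul_of_nonneg_left h1 h3, mul_le_mul_of_nonneg_right h2 hεh]
  have hpos : 0 ≤ CH * εh := by positivity
  linarith
end

section
/- Let A : G → H be a continuous linear map between real Hilbert spaces and let x ∈ H. Then there exists g* ∈ G with ‖A g* − x‖ ≤ ‖A g − x‖ for all g ∈ G (i.e., the problem min_g ‖A g − x‖² admits a minimizer) if and only if x can be written as x = a + b with a in the range of A and b in the orthogonal complement of the range of A. -/
open scoped RealInnerProductSpace

/-- The least-squares problem `min_g ‖A g - x‖` admits a minimizer iff `x`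
decomposes as `a + b` with `a` in the range of `A` and `b` orthogonal to the
range of `A`. -/
theorem least_squares_minimizer_iff_decomposition
    {G H : Type*} [NormedAddCommGroup G] [InnerProductSpace ℝ G] [CompleteSpace G]
    [NormedAddCommGroup H] [InnerProductSpace ℝ H] [CompleteSpace H]
    (A : G →L[ℝ] H) (x : H) :
    (∃ gs : G, ∀ g : G, ‖A gs - x‖ ≤ ‖A g - x‖) ↔
      (∃ a ∈ Set.range A, ∃ b : H, (∀ g : G, ⟪b, A g⟫ = 0) ∧ x = a + b) := by
  constructor
  · rintro ⟨gs, hgs⟩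
    refine ⟨A gs, ⟨gs, rfl⟩, x - A gs, ?_, by abel⟩
    have hmem : A gs ∈ LinearMap.range (A : G →ₗ[ℝ] H) := ⟨gs, rfl⟩
    have key := (Submodule.norm_eq_iInf_iff_real_inner_eq_zero
      (LinearMap.range (A : G →ₗ[ℝ] H)) (u := x) hmem).1 ?_
    · intro g
      exact key (A g) ⟨g, rfl⟩
    · apply le_antisymm
      · haveI : Nonempty ((LinearMap.range (A : G →ₗ[ℝ] H) : Submodule ℝ H) : Set H) :=
          ⟨⟨A gs, hmem⟩⟩
        apply le_ciInf
        rintro ⟨w, g, rfl⟩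
        have h := hgs g
        rw [norm_sub_rev, norm_sub_rev (A g)] at h
        exact h
      · exact ciInf_le (f := fun w : ((LinearMap.range (A : G →ₗ[ℝ] H) : Submodule ℝ H) : Set H) =>
          ‖x - w‖) ⟨0, by rintro _ ⟨w, rfl⟩; exact norm_nonneg _⟩ ⟨A gs, hmem⟩
  · rintro ⟨_, ⟨gs, rfl⟩, b, hb, rfl⟩
    refine ⟨gs, fun g => ?_⟩
    have e1 : A gs - (A gs + b) = -b := by abel
    have e2 : A g - (A gs + b) = -(b - A (g - gs)) := by rw [map_sub]; abel
    rw [e1, e2, norm_neg, norm_neg]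
    have h := norm_sub_sq_real b (A (g - gs))
    rw [hb] at h
    nlinarith [norm_nonneg b, norm_nonneg (b - A (g - gs)), sq_nonneg ‖A (g - gs)‖]
end

section
/- Let 𝓗 ⊆ H and 𝓖 ⊆ G be subsets such that h0 ∈ 𝓗 and there exists ḡ0 ∈ 𝓖 with T* ḡ0 = h0. Let M ≥ 0 and let L_n : H × G → ℝ satisfy |L_n(h,g) − L(h,g)| ≤ M for all h ∈ 𝓗 and g ∈ 𝓖, and assume for each h ∈ 𝓗 the set {L_n(h,g) : g ∈ 𝓖} is bounded above. Then for every ĥ ∈ 𝓗, sup{L_n(h0, g) : g ∈ 𝓖} ≤ sup{L_n(ĥ, g) : g ∈ 𝓖} + 2·M; that is, h0 is a 2M-approximate minimizer over 𝓗 of the empirical worst-case objective h ↦ sup_{g ∈ 𝓖} L_n(h,g). -/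
open scoped RealInnerProductSpace

/-- `h0` is a `2M`-approximate minimizer over `𝓗` of the empirical worst-case
objective `h ↦ sup_{g ∈ 𝓖} L_n(h, g)`. -/
theorem h0_approximate_empirical_minimizer
    {H G : Type*} [NormedAddCommGroup H] [InnerProductSpace ℝ H] [CompleteSpace H]
    [NormedAddCommGroup G] [InnerProductSpace ℝ G] [CompleteSpace G]
    (T : H →L[ℝ] G) (r0 : G) (hr0 : r0 ∈ Set.range T)
    (h0 : H) (hh0 : T h0 = r0) (hmin : ∀ h : H, T h = r0 → ‖h0‖ ≤ ‖h‖)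
    (L : H → G → ℝ)
    (hL : ∀ (h : H) (g : G), L h g = (1/2) * ⟪h, h⟫ + ⟪r0 - T h, g⟫)
    (𝓗 : Set H) (𝓖 : Set G)
    (hH : h0 ∈ 𝓗) (hG : ∃ g0 ∈ 𝓖, ContinuousLinearMap.adjoint T g0 = h0)
    (M : ℝ) (hM : 0 ≤ M)
    (Ln : H → G → ℝ)
    (hLn : ∀ h ∈ 𝓗, ∀ g ∈ 𝓖, |Ln h g - L h g| ≤ M)
    (hbdd : ∀ h ∈ 𝓗, BddAbove ((fun g => Ln h g) '' 𝓖)) :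
    ∀ hHat ∈ 𝓗,
      sSup ((fun g => Ln h0 g) '' 𝓖) ≤ sSup ((fun g => Ln hHat g) '' 𝓖) + 2 * M := by
  intro k hk
  obtain ⟨g0, hg0, hadj⟩ := hG
  have e1 : ⟪r0 - T k, g0⟫ = ⟪h0, h0⟫ - ⟪k, h0⟫ := by
    rw [← hh0, ← map_sub, ← ContinuousLinearMap.adjoint_inner_right, hadj, inner_sub_left]
  have e2 : 0 ≤ ⟪k - h0, k - h0⟫ := real_inner_self_nonneg
  rw [inner_sub_left, inner_sub_right, inner_sub_right, real_inner_comm k h0] at e2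
  have e3 : Ln k g0 ≤ sSup ((fun g => Ln k g) '' 𝓖) :=
    le_csSup (hbdd k hk) ⟨g0, hg0, rfl⟩
  have e4 := abs_le.mp (hLn k hk g0 hg0)
  have e5 := hL k g0
  refine csSup_le ⟨_, g0, hg0, rfl⟩ ?_
  rintro _ ⟨g, hg, rfl⟩
  have e6 := abs_le.mp (hLn h0 hH g hg)
  have e7 := hL h0 g
  rw [hh0, sub_self, inner_zero_left] at e7
  have e8 := real_inner_comm k h0
  dsimp only
  linarith [e4.1, e6.2]
end

section
/- Let 𝓗 ⊆ H and 𝓖 ⊆ G be subsets such that h0 ∈ 𝓗 and there exists ḡ0 ∈ 𝓖 with T* ḡ0 = h0. Let M, μ ≥ 0 and let L_n : H × G → ℝ satisfy |L_n(h,g) − L(h,g)| ≤ M for all h ∈ 𝓗 and g ∈ 𝓖, and assume for each h ∈ 𝓗 the set {L_n(h,g) : g ∈ 𝓖} is bounded above. Then every h ∈ 𝓗 satisfying sup{L_n(h, g) : g ∈ 𝓖} ≤ sup{L_n(h0, g) : g ∈ 𝓖} + μ (i.e., every element of the empirical confidence ball of radius μ around the empirical minimax value) satisfies (1/2)‖h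 − h0‖² ≤ 2·M + μ. -/
open scoped RealInnerProductSpace

/-- Every element of the empirical confidence ball of radius `μ` around the
empirical minimax value at `h0` satisfies `(1/2)‖h - h0‖² ≤ 2M + μ`. -/
theorem confidence_ball_L2_bound
    {H G : Type*} [NormedAddCommGroup H] [InnerProductSpace ℝ H] [CompleteSpace H]
    [NormedAddCommGroup G] [InnerProductSpace ℝ G] [CompleteSpace G]
    (T : H →L[ℝ] G) (r0 : G) (hr0 : r0 ∈ Set.range T)
    (h0 : H) (hh0 : T h0 = r0) (hmin : ∀ h : H, T h = r0 → ‖h0‖ ≤ ‖h‖)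
    (L : H → G → ℝ)
    (hL : ∀ (h : H) (g : G), L h g = (1/2) * ⟪h, h⟫ + ⟪r0 - T h, g⟫)
    (𝓗 : Set H) (𝓖 : Set G)
    (hH : h0 ∈ 𝓗) (hG : ∃ g0 ∈ 𝓖, ContinuousLinearMap.adjoint T g0 = h0)
    (M μ : ℝ) (hM : 0 ≤ M) (hμ : 0 ≤ μ)
    (Ln : H → G → ℝ)
    (hLn : ∀ h ∈ 𝓗, ∀ g ∈ 𝓖, |Ln h g - L h g| ≤ M)
    (hbdd : ∀ h ∈ 𝓗, BddAbove ((fun g => Ln h g) '' 𝓖)) :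
    ∀ h ∈ 𝓗,
      sSup ((fun g => Ln h g) '' 𝓖) ≤ sSup ((fun g => Ln h0 g) '' 𝓖) + μ →
      (1/2) * ‖h - h0‖ ^ 2 ≤ 2 * M + μ := by
  intro h hh hs
  obtain ⟨g0, hg0, hadj⟩ := hG
  have h1 : Ln h g0 ≤ sSup ((fun g => Ln h g) '' 𝓖) :=
    le_csSup (hbdd h hh) ⟨g0, hg0, rfl⟩
  have h2 : sSup ((fun g => Ln h0 g) '' 𝓖) ≤ (1/2) * ⟪h0, h0⟫ + M := by
    refine csSup_le (Set.Nonempty.image _ ⟨g0, hg0⟩) ?_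
    rintro _ ⟨g, hg, rfl⟩
    have h3 := (abs_le.mp (hLn h0 hH g hg)).2
    rw [hL, hh0, sub_self, inner_zero_left] at h3
    simp only
    linarith
  have h4 := (abs_le.mp (hLn h hh g0 hg0)).1
  have h5 : ⟪r0 - T h, g0⟫ = ⟪h0, h0⟫ - ⟪h, h0⟫ := by
    rw [← hh0, ← map_sub, ← ContinuousLinearMap.adjoint_inner_right, hadj, inner_sub_left]
  rw [hL, h5] at h4
  have h6 : ‖h - h0‖ ^ 2 = ⟪h, h⟫ - 2 * ⟪h, h0⟫ + ⟪h0, h0⟫ := by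
    rw [norm_sub_sq_real, real_inner_self_eq_norm_sq, real_inner_self_eq_norm_sq]
  rw [h6]
  linarith
end
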